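/- Let B be a fractional Brownian motion with Hurst parameter H ∈ (0, 3/4), p ∈ {2} ∪ [3, ∞), λ > 1 an integer, and define the power variation V_n^p(B) = Σ_{j=0}^{n-1} |B_{(j+1)/n} - B_{j/n}|^p, the statistic T_{λ,n} = V_{λn}^p(B)/V_n^p(B), and the estimator Ĥ_{λ,n} = (1/p)(1 - log T_{λ,n} / log λ). Then √(n / log n) · (Ĥ_{λ,n} - H) → 0 in probability as n → ∞. -/

import Mathlib

open MeasureTheory ProbabilityTheory Filter

/-- The symmetric second difference of `x ↦ x ^ q` at `1` is quadratically small. -/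
lemma exists_second_difference_rpow_one_le (q : ℝ) :
    ∃ C : ℝ, 0 ≤ C ∧ ∀ u ∈ Set.Icc (0 : ℝ) (1 / 2),
      |(1 + u) ^ q + (1 - u) ^ q - 2| ≤ C * u ^ 2 := by
  set f : ℝ → ℝ := fun u => (1 + u) ^ q + (1 - u) ^ q - 2 with hf
  have hsmooth : ContDiffOn ℝ ((1 : ℕ) + 1) f (Set.Icc 0 (1 / 2)) := by
    refine ((ContDiffOn.rpow_const_of_ne ?_ ?_).add
      (ContDiffOn.rpow_const_of_ne ?_ ?_)).sub contDiffOn_const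
    · fun_prop
    · rintro x ⟨h₀, -⟩; positivity
    · fun_prop
    · rintro x ⟨-, h₁⟩; linarith
  have hderiv : derivWithin f (Set.Icc 0 (1 / 2)) 0 = 0 := by
    have h₁ : HasDerivAt (fun u : ℝ => (1 + u) ^ q) (1 * q * (1 + 0) ^ (q - 1)) 0 :=
      ((hasDerivAt_id' (0 : ℝ)).const_add 1).rpow_const (Or.inl (by norm_num))
    have h₂ : HasDerivAt (fun u : ℝ => (1 - u) ^ q) (-1 * q * (1 - 0) ^ (q - 1)) 0 :=
      ((hasDerivAt_id' (0 : ℝ)).const_sub 1).rpow_const (Or.inl (by norm_num))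
    have h : HasDerivAt f 0 0 := ((h₁.add h₂).sub_const 2).congr_deriv (by simp)
    exact h.hasDerivWithinAt.derivWithin
      (uniqueDiffOn_Icc (by norm_num) 0 ⟨le_rfl, by norm_num⟩)
  obtain ⟨C, hC⟩ := exists_taylor_mean_remainder_bound (by norm_num) hsmooth
  refine ⟨max C 0, le_max_right _ _, fun u hu => ?_⟩
  have h := hC u hu
  have hf₀ : f 0 = 0 := by norm_num [hf]
  rw [taylorWithinEval_succ, taylor_within_zero_eval, iteratedDerivWithin_one, hderiv, hf₀] at h
  simp only [smul_zero, add_zero, sub_zero, Real.norm_eq_abs] at h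
  exact h.trans (mul_le_mul_of_nonneg_right (le_max_left _ _) (sq_nonneg u))

lemma exists_second_difference_abs_rpow_le {p : ℝ} (hp : 2 ≤ p) :
    ∃ C : ℝ, 0 ≤ C ∧ ∀ a b : ℝ,
      |(|a + b| ^ p + |a - b| ^ p - 2 * |a| ^ p)| ≤
        C * (b ^ 2 * (|a| ^ (p - 2) + |b| ^ (p - 2))) := by
  obtain ⟨C, hC₀, hC⟩ := exists_second_difference_rpow_one_le p
  refine ⟨max C (2 * 3 ^ p + 2 * 2 ^ p), le_max_of_le_left hC₀, fun a b => ?_⟩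
  have hsplit : ∀ x : ℝ, x ≠ 0 → |x| ^ p = x ^ 2 * |x| ^ (p - 2) := fun x hx => by
    rw [← sq_abs x, ← Real.rpow_natCast, ← Real.rpow_add (abs_pos.2 hx)]
    congr 1
    push_cast
    ring
  rcases eq_or_ne b 0 with rfl | hb
  · simp [two_mul]
  rcases le_or_gt |b| (|a| / 2) with hab | hab
  · have ha : a ≠ 0 := by
      rintro rfl
      simp at hab
      exact hb hab
    have ha' : 0 < |a| := abs_pos.2 ha
    have hu : |b / a| ≤ 1 / 2 := by
      rw [abs_div, div_le_iff₀ ha']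
      linarith
    have key : |(|1 + b / a| ^ p + |1 - b / a| ^ p - 2)| ≤ C * (b / a) ^ 2 := by
      have h := hC |b / a| ⟨abs_nonneg _, hu⟩
      rw [sq_abs] at h
      obtain ⟨h₁, h₂⟩ := abs_le.1 hu
      rw [abs_of_nonneg (by linarith : 0 ≤ 1 + b / a),
        abs_of_nonneg (by linarith : 0 ≤ 1 - b / a)]
      rcases abs_cases (b / a) with ⟨h', -⟩ | ⟨h', -⟩ <;> rw [h'] at h
      · exact h
      · rwa [sub_neg_eq_add, ← sub_eq_add_neg, add_comm ((1 - b / a) ^ p)] at h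
    have h₁ : |a + b| ^ p = |a| ^ p * |1 + b / a| ^ p := by
      rw [← Real.mul_rpow (abs_nonneg _) (abs_nonneg _), ← abs_mul]
      congr 2
      field_simp
    have h₂ : |a - b| ^ p = |a| ^ p * |1 - b / a| ^ p := by
      rw [← Real.mul_rpow (abs_nonneg _) (abs_nonneg _), ← abs_mul]
      congr 2
      field_simp
    have hfac : |a| ^ p * |1 + b / a| ^ p + |a| ^ p * |1 - b / a| ^ p - 2 * |a| ^ p =
        |a| ^ p * (|1 + b / a| ^ p + |1 - b / a| ^ p - 2) := by ring
    rw [h₁, h₂, hfac, abs_mul, abs_of_nonneg (by positivity : 0 ≤ |a| ^ p)]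
    calc |a| ^ p * |(|1 + b / a| ^ p + |1 - b / a| ^ p - 2)|
        ≤ |a| ^ p * (C * (b / a) ^ 2) := by gcongr
      _ = C * (b ^ 2 * |a| ^ (p - 2)) := by
          rw [hsplit a ha]
          field_simp
      _ ≤ _ := by
          gcongr
          · exact le_max_left _ _
          · exact le_add_of_nonneg_right (by positivity)
  · have hp₀ : 0 ≤ p := by linarith
    have h₁ : |a + b| ^ p ≤ 3 ^ p * |b| ^ p := by
      rw [← Real.mul_rpow (by norm_num) (abs_nonneg _)]
      exact Real.rpow_le_rpow (abs_nonneg _) ((abs_add_le a b).trans (by linarith)) hp₀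
    have h₂ : |a - b| ^ p ≤ 3 ^ p * |b| ^ p := by
      rw [← Real.mul_rpow (by norm_num) (abs_nonneg _)]
      exact Real.rpow_le_rpow (abs_nonneg _) ((abs_sub a b).trans (by linarith)) hp₀
    have h₃ : |a| ^ p ≤ 2 ^ p * |b| ^ p := by
      rw [← Real.mul_rpow (by norm_num) (abs_nonneg _)]
      exact Real.rpow_le_rpow (abs_nonneg _) (by linarith) hp₀
    have h₄ : 0 ≤ |a + b| ^ p := by positivity
    have h₅ : 0 ≤ |a - b| ^ p := by positivity
    have h₆ : 0 ≤ |a| ^ p := by positivity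
    calc |(|a + b| ^ p + |a - b| ^ p - 2 * |a| ^ p)|
        ≤ (2 * 3 ^ p + 2 * 2 ^ p) * |b| ^ p := by
          rw [abs_le]
          have : (0 : ℝ) ≤ 3 ^ p * |b| ^ p := by positivity
          have : (0 : ℝ) ≤ 2 ^ p * |b| ^ p := by positivity
          constructor <;> nlinarith
      _ = (2 * 3 ^ p + 2 * 2 ^ p) * (b ^ 2 * |b| ^ (p - 2)) := by rw [hsplit b hb]
      _ ≤ _ := by
          gcongr
          · exact le_max_right _ _
          · exact le_add_of_nonneg_left (by positivity)

lemma integrable_abs_rpow_gaussianReal {a : ℝ} (ha : 0 ≤ a) :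
    Integrable (fun x : ℝ => |x| ^ a) (gaussianReal 0 1) := by
  simpa [Real.coe_toNNReal a ha] using
    (memLp_id_gaussianReal (μ := 0) (v := 1) a.toNNReal).integrable_norm_rpow'

lemma integral_abs_rpow_gaussianReal_pos {a : ℝ} (ha : 0 < a) :
    0 < ∫ x, |x| ^ a ∂gaussianReal 0 1 := by
  rw [integral_pos_iff_support_of_nonneg (fun x => by positivity)
    (integrable_abs_rpow_gaussianReal ha.le)]
  have hsupp : Function.support (fun x : ℝ => |x| ^ a) = {0}ᶜ := by
    ext x
    simp [Real.rpow_eq_zero (abs_nonneg x) ha.ne']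
  have := nullSingletonClass_gaussianReal (μ := 0) (v := 1) one_ne_zero
  rw [hsupp, prob_compl_eq_one_sub (measurableSet_singleton 0), measure_singleton]
  simp

/-- The fractional Gaussian noise covariance. -/
noncomputable def fgnCov (H x : ℝ) : ℝ :=
  (|x + 1| ^ (2 * H) + |x - 1| ^ (2 * H) - 2 * |x| ^ (2 * H)) / 2

lemma fgnCov_neg (H x : ℝ) : fgnCov H (-x) = fgnCov H x := by
  have h₁ : |-x + 1| = |x - 1| := by rw [← abs_neg]; congr 1; ring
  have h₂ : |-x - 1| = |x + 1| := by rw [← abs_neg]; congr 1; ring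
  simp only [fgnCov, h₁, h₂, abs_neg]
  ring

lemma summable_fgnCov_sq {H : ℝ} (hH : H < 3 / 4) :
    Summable fun k : ℤ => fgnCov H k ^ 2 := by
  have hnat : Summable fun k : ℕ => fgnCov H k ^ 2 := by
    obtain ⟨C, hC₀, hC⟩ := exists_second_difference_rpow_one_le (2 * H)
    have hs : Summable fun k : ℕ => C ^ 2 * (k : ℝ) ^ (4 * H - 4) :=
      (Real.summable_nat_rpow.2 (by linarith)).mul_left _
    refine hs.of_norm_bounded_eventually_nat ?_
    filter_upwards [eventually_ge_atTop 2] with k hk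
    have hk' : (2 : ℝ) ≤ k := by exact_mod_cast hk
    have hk₀ : (0 : ℝ) < k := by linarith
    have hinv : (1 / k : ℝ) ≤ 1 / 2 := one_div_le_one_div_of_le (by norm_num) hk'
    have h := hC (1 / k) ⟨by positivity, hinv⟩
    have h₁ : |(k : ℝ) + 1| ^ (2 * H) = (k : ℝ) ^ (2 * H) * (1 + 1 / k) ^ (2 * H) := by
      rw [← Real.mul_rpow hk₀.le (by positivity), abs_of_pos (by positivity)]
      congr 1
      field_simp
    have h₂ : |(k : ℝ) - 1| ^ (2 * H) = (k : ℝ) ^ (2 * H) * (1 - 1 / k) ^ (2 * H) := by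
      rw [← Real.mul_rpow hk₀.le (by linarith), abs_of_pos (by linarith)]
      congr 1
      field_simp
    have hfac : fgnCov H k =
        (k : ℝ) ^ (2 * H) / 2 * ((1 + 1 / k : ℝ) ^ (2 * H) + (1 - 1 / k) ^ (2 * H) - 2) := by
      rw [fgnCov, h₁, h₂, abs_of_pos hk₀]
      ring
    have hbound : |fgnCov H k| ≤ C * (k : ℝ) ^ (2 * H - 2) := by
      rw [hfac, abs_mul, abs_of_nonneg (by positivity : 0 ≤ (k : ℝ) ^ (2 * H) / 2)]
      calc _ ≤ (k : ℝ) ^ (2 * H) / 2 * (C * (1 / k) ^ 2) := by gcongr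
        _ = C * (k : ℝ) ^ (2 * H - 2) / 2 := by
          rw [Real.rpow_sub hk₀, Real.rpow_two]
          field_simp
        _ ≤ _ := half_le_self (by positivity)
    rw [Real.norm_eq_abs, abs_pow]
    calc |fgnCov H k| ^ 2 ≤ (C * (k : ℝ) ^ (2 * H - 2)) ^ 2 := by gcongr
      _ = C ^ 2 * (k : ℝ) ^ (4 * H - 4) := by
        rw [mul_pow, ← Real.rpow_natCast ((k : ℝ) ^ _), ← Real.rpow_mul hk₀.le]
        congr 2
        push_cast
        ring
  refine Summable.of_nat_of_neg ?_ ?_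
  · simpa using hnat
  · simpa [fgnCov_neg] using hnat

/-- The sum of the squared correlations of `n` consecutive increments grows at most linearly. -/
lemma sum_fgnCov_sq_le {H : ℝ} (hH : H < 3 / 4) (n : ℕ) :
    ∑ j ∈ Finset.range n, ∑ k ∈ Finset.range n, fgnCov H ((j : ℝ) - k) ^ 2 ≤
      n * ∑' k : ℤ, fgnCov H k ^ 2 := by
  have hs := summable_fgnCov_sq hH
  rw [← nsmul_eq_mul, ← Finset.card_range n, ← Finset.sum_const, Finset.card_range]
  refine Finset.sum_le_sum fun j _ => ?_
  have hinj : Function.Injective fun k : ℕ => (j : ℤ) - k := fun a b h => by simpa using h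
  calc ∑ k ∈ Finset.range n, fgnCov H ((j : ℝ) - k) ^ 2
      = ∑ k ∈ Finset.range n, ((fun k : ℤ => fgnCov H k ^ 2) ∘ fun k : ℕ => (j : ℤ) - k) k := by
        simp
    _ ≤ ∑' k : ℕ, ((fun k : ℤ => fgnCov H k ^ 2) ∘ fun k : ℕ => (j : ℤ) - k) k :=
        (hs.comp_injective hinj).sum_le_tsum _ fun _ _ => sq_nonneg _
    _ ≤ _ := tsum_comp_le_tsum_of_inj hs (fun _ => sq_nonneg _) hinj

/-- Two standard normal variables with correlation `r`, all of whose linear combinations are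
Gaussian, are jointly distributed as `(ξ, r ξ + √(1 - r ^ 2) ζ)` with `ξ`, `ζ` independent. -/
lemma map_prodMk_eq_of_linear_combinations_gaussian {Ω : Type*} [MeasurableSpace Ω]
    {P : Measure Ω} [IsProbabilityMeasure P] {X Y : Ω → ℝ} (hX : Measurable X) (hY : Measurable Y)
    {r : ℝ} (hr : |r| ≤ 1)
    (hXY : ∀ α β : ℝ, ∃ v : NNReal, (v : ℝ) = α ^ 2 + β ^ 2 + 2 * α * β * r ∧
      P.map (fun ω => α * X ω + β * Y ω) = gaussianReal 0 v) :
    P.map (fun ω => (X ω, Y ω)) = ((gaussianReal 0 1).prod (gaussianReal 0 1)).map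
      (fun z => (z.1, r * z.1 + √(1 - r ^ 2) * z.2)) := by
  set s := √(1 - r ^ 2) with hs
  have hs2 : s ^ 2 = 1 - r ^ 2 :=
    Real.sq_sqrt (sub_nonneg.2 ((sq_le_one_iff_abs_le_one r).2 hr))
  have hm : Measurable fun ω => (X ω, Y ω) := hX.prodMk hY
  have hm' : Measurable fun z : ℝ × ℝ => (z.1, r * z.1 + s * z.2) := by fun_prop
  have := Measure.isProbabilityMeasure_map (μ := P) hm.aemeasurable
  have := Measure.isProbabilityMeasure_map
    (μ := (gaussianReal 0 1).prod (gaussianReal 0 1)) hm'.aemeasurable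
  refine Measure.ext_of_charFunDual (funext fun L => ?_)
  have hL : ∀ x y : ℝ, L (x, y) = L (1, 0) * x + L (0, 1) * y := fun x y => by
    have : ((x, y) : ℝ × ℝ) = x • (1, 0) + y • (0, 1) := by simp
    rw [this, map_add, map_smul, map_smul, smul_eq_mul, smul_eq_mul]
    ring
  rw [charFunDual_eq_charFun_map_one, charFunDual_eq_charFun_map_one]
  congr 1
  rw [Measure.map_map L.continuous.measurable hm, Measure.map_map L.continuous.measurable hm']
  set α := L (1, 0)
  set β := L (0, 1)
  obtain ⟨v, hv, hmap⟩ := hXY α β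
  have h₁ : (⇑L ∘ fun ω => (X ω, Y ω)) = fun ω => α * X ω + β * Y ω := funext fun ω => hL _ _
  have h₂ : (⇑L ∘ fun z : ℝ × ℝ => (z.1, r * z.1 + s * z.2)) =
      (fun z : ℝ × ℝ => (α + β * r) * z.1) + fun z : ℝ × ℝ => (β * s) * z.2 := by
    ext z
    simp only [Function.comp_apply, hL, Pi.add_apply]
    ring
  have hfst : ((gaussianReal 0 1).prod (gaussianReal 0 1)).map
      (fun z : ℝ × ℝ => (α + β * r) * z.1) =
      gaussianReal 0 (NNReal.mk ((α + β * r) ^ 2) (sq_nonneg _)) := by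
    rw [← Function.comp_def (fun x : ℝ => (α + β * r) * x) Prod.fst,
      ← Measure.map_map (by fun_prop) measurable_fst, Measure.map_fst_prod, measure_univ, one_smul,
      gaussianReal_map_const_mul, mul_zero, mul_one]
  have hsnd : ((gaussianReal 0 1).prod (gaussianReal 0 1)).map
      (fun z : ℝ × ℝ => (β * s) * z.2) =
      gaussianReal 0 (NNReal.mk ((β * s) ^ 2) (sq_nonneg _)) := by
    rw [← Function.comp_def (fun x : ℝ => (β * s) * x) Prod.snd,
      ← Measure.map_map (by fun_prop) measurable_snd, Measure.map_snd_prod, measure_univ, one_smul,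
      gaussianReal_map_const_mul, mul_zero, mul_one]
  rw [h₁, h₂, hmap, gaussianReal_add_gaussianReal_of_indepFun
    (indepFun_prod (X := fun x : ℝ => (α + β * r) * x) (Y := fun x : ℝ => (β * s) * x)
      (by fun_prop) (by fun_prop)) hfst hsnd, add_zero]
  congr 1
  ext
  rw [hv, NNReal.coe_add]
  change _ = (α + β * r) ^ 2 + (β * s) ^ 2
  rw [mul_pow, hs2]
  ring

/-- The covariance of `|ξ| ^ p` and `|η| ^ p` is quadratically small in the correlation of the
standard Gaussian pair `(ξ, η)`. -/
lemma exists_abs_rpow_gaussian_covariance_le {p : ℝ} (hp : 2 ≤ p) :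
    ∃ K : ℝ, 0 ≤ K ∧ ∀ r : ℝ, |r| ≤ 1 →
      |(∫ z : ℝ × ℝ, |z.1| ^ p * |r * z.1 + √(1 - r ^ 2) * z.2| ^ p
          ∂(gaussianReal 0 1).prod (gaussianReal 0 1)) -
        (∫ x, |x| ^ p ∂gaussianReal 0 1) ^ 2| ≤ K * r ^ 2 := by
  obtain ⟨C, hC₀, hC⟩ := exists_second_difference_abs_rpow_le hp
  set γ := gaussianReal 0 1 with hγ
  set M : ℝ → ℝ := fun a => ∫ x, |x| ^ a ∂γ with hM
  have hM₀ : ∀ a, 0 ≤ M a := fun a => integral_nonneg fun x => by positivity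
  have hp₀ : 0 ≤ p := by linarith
  have hint : ∀ {a b : ℝ}, 0 ≤ a → 0 ≤ b →
      Integrable (fun z : ℝ × ℝ => |z.1| ^ a * |z.2| ^ b) (γ.prod γ) := fun ha hb =>
    (integrable_abs_rpow_gaussianReal ha).mul_prod (integrable_abs_rpow_gaussianReal hb)
  have hval : ∀ a b : ℝ, ∫ z : ℝ × ℝ, |z.1| ^ a * |z.2| ^ b ∂γ.prod γ = M a * M b := fun a b =>
    integral_prod_mul (fun x : ℝ => |x| ^ a) (fun x : ℝ => |x| ^ b)
  refine ⟨C * (M (p + 2) * M (p - 2) + M (2 * p)) + p * M p ^ 2, ?_, fun r hr => ?_⟩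
  · have := hM₀ (p + 2)
    have := hM₀ (p - 2)
    have := hM₀ (2 * p)
    positivity
  set s := √(1 - r ^ 2) with hs
  have hr2 : r ^ 2 ≤ 1 := (sq_le_one_iff_abs_le_one r).2 hr
  have hs₀ : 0 ≤ s := Real.sqrt_nonneg _
  have hs2 : s ^ 2 = 1 - r ^ 2 := Real.sq_sqrt (sub_nonneg.2 hr2)
  have hs1 : s ≤ 1 := by nlinarith [sq_nonneg r]
  have hsp₀ : 0 ≤ s ^ p := by positivity
  have hsp1 : s ^ p ≤ 1 := Real.rpow_le_one hs₀ hs1 hp₀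
  have hsp : 1 - p / 2 * r ^ 2 ≤ s ^ p := by
    have h := one_add_mul_self_le_rpow_one_add (s := -r ^ 2) (by linarith) (p := p / 2)
      (by linarith)
    have h' : s ^ p = (1 + -r ^ 2) ^ (p / 2) := by
      rw [← sub_eq_add_neg, ← hs2, ← Real.rpow_two, ← Real.rpow_mul hs₀]
      congr 1
      ring
    rw [h']
    linarith
  set F : ℝ → ℝ × ℝ → ℝ := fun t z => |z.1| ^ p * |t * z.1 + s * z.2| ^ p with hF
  have hFint : ∀ t : ℝ, |t| ≤ 1 → Integrable (F t) (γ.prod γ) := fun t ht => by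
    have hdom : Integrable (fun z : ℝ × ℝ => 2 ^ p * (|z.1| ^ (2 * p) * |z.2| ^ (0 : ℝ)) +
        2 ^ p * (|z.1| ^ p * |z.2| ^ p)) (γ.prod γ) :=
      ((hint (by positivity) le_rfl).const_mul _).add ((hint hp₀ hp₀).const_mul _)
    refine hdom.mono' (by fun_prop) (ae_of_all _ fun z => ?_)
    have h : |t * z.1 + s * z.2| ^ p ≤ 2 ^ p * |z.1| ^ p + 2 ^ p * |z.2| ^ p := by
      have h₀ : |t * z.1 + s * z.2| ≤ |z.1| + |z.2| := by
        refine (abs_add_le _ _).trans (add_le_add ?_ ?_)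
        · rw [abs_mul]
          exact mul_le_of_le_one_left (abs_nonneg _) ht
        · rw [abs_mul, abs_of_nonneg hs₀]
          exact mul_le_of_le_one_left (abs_nonneg _) hs1
      have h₁ : 0 ≤ (2 : ℝ) ^ p * |z.1| ^ p := by positivity
      have h₂ : 0 ≤ (2 : ℝ) ^ p * |z.2| ^ p := by positivity
      rcases le_total |z.1| |z.2| with h' | h'
      · have := Real.rpow_le_rpow (abs_nonneg _) (h₀.trans (by linarith : _ ≤ 2 * |z.2|)) hp₀
        rw [Real.mul_rpow (by norm_num) (abs_nonneg _)] at this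
        linarith
      · have := Real.rpow_le_rpow (abs_nonneg _) (h₀.trans (by linarith : _ ≤ 2 * |z.1|)) hp₀
        rw [Real.mul_rpow (by norm_num) (abs_nonneg _)] at this
        linarith
    rw [Real.norm_of_nonneg (by positivity), Real.rpow_zero, mul_one, two_mul p,
      Real.rpow_add_of_nonneg (abs_nonneg _) hp₀ hp₀]
    calc F t z ≤ |z.1| ^ p * (2 ^ p * |z.1| ^ p + 2 ^ p * |z.2| ^ p) := by
          simp only [hF]
          gcongr
      _ = _ := by ring
  have hsymm : ∫ z, F (-r) z ∂γ.prod γ = ∫ z, F r z ∂γ.prod γ := by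
    have hneg : MeasurePreserving (fun x : ℝ => -x) γ γ :=
      ⟨measurable_neg, by rw [hγ, gaussianReal_map_neg, neg_zero]⟩
    have hmp := hneg.prod (MeasurePreserving.id γ)
    have hemb : MeasurableEmbedding (Prod.map (fun x : ℝ => -x) (id : ℝ → ℝ)) :=
      ((MeasurableEquiv.neg ℝ).prodCongr (MeasurableEquiv.refl ℝ)).measurableEmbedding
    rw [← hmp.integral_comp hemb]
    simp [hF]
  set D : ℝ × ℝ → ℝ := fun z =>
    |z.1| ^ p * (|s * z.2 + r * z.1| ^ p + |s * z.2 - r * z.1| ^ p - 2 * |s * z.2| ^ p) with hD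
  have hDeq : ∀ z, D z = F r z + F (-r) z - 2 * s ^ p * (|z.1| ^ p * |z.2| ^ p) := fun z => by
    have e₁ : s * z.2 + r * z.1 = r * z.1 + s * z.2 := by ring
    have e₂ : s * z.2 - r * z.1 = -r * z.1 + s * z.2 := by ring
    simp only [hD, hF, e₁, e₂]
    rw [abs_mul s, abs_of_nonneg hs₀, Real.mul_rpow hs₀ (abs_nonneg _)]
    ring
  have hDint : ∫ z, D z ∂γ.prod γ = 2 * (∫ z, F r z ∂γ.prod γ) - 2 * s ^ p * M p ^ 2 := by
    have hFneg := hFint (-r) (by rwa [abs_neg])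
    have hsum : Integrable (fun z => F r z + F (-r) z) (γ.prod γ) := (hFint r hr).add hFneg
    simp_rw [hDeq]
    rw [integral_sub hsum ((hint hp₀ hp₀).const_mul _), integral_add (hFint r hr) hFneg,
      integral_const_mul, hval, hsymm]
    ring
  have hDbound : |∫ z, D z ∂γ.prod γ| ≤ C * r ^ 2 * (M (p + 2) * M (p - 2) + M (2 * p)) := by
    have hdom : Integrable (fun z : ℝ × ℝ => C * r ^ 2 * (|z.1| ^ (p + 2) * |z.2| ^ (p - 2) +
        |z.1| ^ (2 * p) * |z.2| ^ (0 : ℝ))) (γ.prod γ) :=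
      ((hint (by positivity) (by linarith)).add (hint (by positivity) le_rfl)).const_mul _
    rw [← Real.norm_eq_abs]
    refine (norm_integral_le_of_norm_le hdom (ae_of_all _ fun z => ?_)).trans_eq ?_
    · have h₁ : |s * z.2| ^ (p - 2) ≤ |z.2| ^ (p - 2) := by
        refine Real.rpow_le_rpow (abs_nonneg _) ?_ (by linarith)
        rw [abs_mul, abs_of_nonneg hs₀]
        exact mul_le_of_le_one_left (abs_nonneg _) hs1
      have h₂ : |r * z.1| ^ (p - 2) ≤ |z.1| ^ (p - 2) := by
        refine Real.rpow_le_rpow (abs_nonneg _) ?_ (by linarith)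
        rw [abs_mul]
        exact mul_le_of_le_one_left (abs_nonneg _) hr
      have h₃ : |z.1| ^ (p + 2) = |z.1| ^ p * z.1 ^ 2 := by
        rw [Real.rpow_add_of_nonneg (abs_nonneg _) hp₀ (by norm_num), Real.rpow_two, sq_abs]
      have h₄ : |z.1| ^ (2 * p) = |z.1| ^ p * (z.1 ^ 2 * |z.1| ^ (p - 2)) := by
        rw [← sq_abs, ← Real.rpow_two, ← Real.rpow_add_of_nonneg (abs_nonneg _) (by norm_num)
          (by linarith), ← Real.rpow_add_of_nonneg (abs_nonneg _) hp₀ (by linarith)]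
        congr 1
        ring
      rw [hD, Real.norm_eq_abs, abs_mul, abs_of_nonneg (by positivity : 0 ≤ |z.1| ^ p),
        Real.rpow_zero, mul_one, h₃, h₄]
      calc _ ≤ |z.1| ^ p * (C * ((r * z.1) ^ 2 * (|s * z.2| ^ (p - 2) + |r * z.1| ^ (p - 2)))) := by
            gcongr
            exact hC _ _
        _ ≤ |z.1| ^ p * (C * ((r * z.1) ^ 2 * (|z.2| ^ (p - 2) + |z.1| ^ (p - 2)))) := by gcongr
        _ = _ := by ring
    · rw [integral_const_mul, integral_add (hint (by positivity) (by linarith))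
        (hint (by positivity) le_rfl), hval, hval]
      simp [hM, hγ]
  have hkey : (∫ z, F r z ∂γ.prod γ) - M p ^ 2 =
      (∫ z, D z ∂γ.prod γ) / 2 - (1 - s ^ p) * M p ^ 2 := by
    rw [hDint]
    ring
  change |(∫ z, F r z ∂γ.prod γ) - M p ^ 2| ≤ _
  rw [hkey]
  have hA : 0 ≤ C * r ^ 2 * (M (p + 2) * M (p - 2) + M (2 * p)) := (abs_nonneg _).trans hDbound
  have hB : (1 - s ^ p) * M p ^ 2 ≤ p / 2 * r ^ 2 * M p ^ 2 := by
    gcongr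
    linarith
  have hB₀ : 0 ≤ (1 - s ^ p) * M p ^ 2 := mul_nonneg (by linarith) (sq_nonneg _)
  rw [abs_le] at hDbound ⊢
  constructor <;> nlinarith

section PowerVariation

variable {Ω : Type*} [MeasurableSpace Ω] {P : Measure Ω}

lemma abs_le_one_of_linear_combinations_gaussian {X Y : Ω → ℝ} {r : ℝ}
    (hXY : ∀ α β : ℝ, ∃ v : NNReal, (v : ℝ) = α ^ 2 + β ^ 2 + 2 * α * β * r ∧
      P.map (fun ω => α * X ω + β * Y ω) = gaussianReal 0 v) : |r| ≤ 1 := by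
  obtain ⟨v, hv, -⟩ := hXY (-r) 1
  rw [← sq_le_one_iff_abs_le_one]
  nlinarith [v.coe_nonneg]

lemma map_eq_of_linear_combinations_gaussian {X Y : Ω → ℝ} {r : ℝ}
    (hXY : ∀ α β : ℝ, ∃ v : NNReal, (v : ℝ) = α ^ 2 + β ^ 2 + 2 * α * β * r ∧
      P.map (fun ω => α * X ω + β * Y ω) = gaussianReal 0 v) : P.map X = gaussianReal 0 1 := by
  obtain ⟨v, hv, h⟩ := hXY 1 0
  have hv1 : v = 1 := by
    ext
    rw [hv]
    norm_num
  simpa [hv1] using h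

lemma memLp_two_abs_rpow_of_map_eq {X : Ω → ℝ} (hX : Measurable X)
    (hlaw : P.map X = gaussianReal 0 1) {p : ℝ} (hp : 0 ≤ p) :
    MemLp (fun ω => |X ω| ^ p) 2 P := by
  rw [memLp_two_iff_integrable_sq (by fun_prop)]
  have h : Integrable (fun x : ℝ => |x| ^ (2 * p)) (P.map X) :=
    hlaw ▸ integrable_abs_rpow_gaussianReal (by positivity)
  refine (h.comp_measurable hX).congr (ae_of_all _ fun ω => ?_)
  simp only [Function.comp_apply]
  rw [← Real.rpow_natCast, ← Real.rpow_mul (abs_nonneg _), mul_comm]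
  norm_num

variable {H : ℝ} {B : ℝ → Ω → ℝ}

/-- The increments of fractional Brownian motion over a regular grid, once rescaled, are
jointly Gaussian with the fractional Gaussian noise covariance. -/
lemma exists_map_linear_combination_increments (hH : 0 < H)
    (hgauss : ∀ (n : ℕ) (t : Fin n → ℝ) (a : Fin n → ℝ), ∃ v : NNReal,
      (v : ℝ) = ∑ i, ∑ j, a i * a j *
          ((|t i| ^ (2 * H) + |t j| ^ (2 * H) - |t i - t j| ^ (2 * H)) / 2) ∧
      P.map (fun ω => ∑ i, a i * B (t i) ω) = gaussianReal 0 v)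
    {n : ℕ} (hn : 0 < n) (j k : ℕ) (α β : ℝ) :
    ∃ v : NNReal, (v : ℝ) = α ^ 2 + β ^ 2 + 2 * α * β * fgnCov H ((j : ℝ) - k) ∧
      P.map (fun ω => α * ((n : ℝ) ^ H * (B (((j : ℝ) + 1) / n) ω - B ((j : ℝ) / n) ω)) +
        β * ((n : ℝ) ^ H * (B (((k : ℝ) + 1) / n) ω - B ((k : ℝ) / n) ω))) =
      gaussianReal 0 v := by
  have hn' : (0 : ℝ) < n := by exact_mod_cast hn
  obtain ⟨v, hv, hmap⟩ := hgauss 4 ![((j : ℝ) + 1) / n, (j : ℝ) / n, ((k : ℝ) + 1) / n, (k : ℝ) / n]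
    ![α * (n : ℝ) ^ H, -(α * (n : ℝ) ^ H), β * (n : ℝ) ^ H, -(β * (n : ℝ) ^ H)]
  refine ⟨v, ?_, ?_⟩
  · have hN : (n : ℝ) ^ H * (n : ℝ) ^ H * ((n : ℝ) ^ (2 * H))⁻¹ = 1 := by
      rw [← Real.rpow_add hn', ← two_mul]
      exact mul_inv_cancel₀ (by positivity)
    have hz : (0 : ℝ) ^ (2 * H) = 0 := Real.zero_rpow (by positivity)
    have hdiff : ∀ x y : ℝ, |x / n - y / n| ^ (2 * H) =
        |x - y| ^ (2 * H) * ((n : ℝ) ^ (2 * H))⁻¹ := fun x y => by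
      rw [← sub_div, abs_div, abs_of_pos hn', Real.div_rpow (abs_nonneg _) hn'.le, div_eq_mul_inv]
    have e₁ : |(j : ℝ) + 1 - j| = 1 := by simp
    have e₂ : |(j : ℝ) - (j + 1)| = 1 := by simp
    have e₃ : |(k : ℝ) + 1 - k| = 1 := by simp
    have e₄ : |(k : ℝ) - (k + 1)| = 1 := by simp
    have e₅ : |(j : ℝ) + 1 - (k + 1)| = |(j : ℝ) - k| := by congr 1; ring
    have e₆ : |(k : ℝ) + 1 - (j + 1)| = |(j : ℝ) - k| := by rw [abs_sub_comm]; ring_nf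
    have e₇ : |(k : ℝ) - j| = |(j : ℝ) - k| := abs_sub_comm _ _
    have e₈ : |(j : ℝ) + 1 - k| = |(j : ℝ) - k + 1| := by congr 1; ring
    have e₉ : |(k : ℝ) - (j + 1)| = |(j : ℝ) - k + 1| := by rw [abs_sub_comm]; ring_nf
    have e₁₀ : |(j : ℝ) - (k + 1)| = |(j : ℝ) - k - 1| := by congr 1; ring
    have e₁₁ : |(k : ℝ) + 1 - j| = |(j : ℝ) - k - 1| := by rw [abs_sub_comm]; ring_nf
    rw [hv]
    simp only [Fin.sum_univ_four, Matrix.cons_val, hdiff]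
    simp only [sub_self, abs_zero, hz, e₁, e₂, e₃, e₄, e₅, e₆, e₇, e₈, e₉, e₁₀, e₁₁,
      Real.one_rpow, fgnCov]
    linear_combination (α ^ 2 + β ^ 2 + α * β * (|(j : ℝ) - k + 1| ^ (2 * H) +
      |(j : ℝ) - k - 1| ^ (2 * H) - 2 * |(j : ℝ) - k| ^ (2 * H))) * hN
  · rw [← hmap]
    congr 1
    ext ω
    simp only [Fin.sum_univ_four, Matrix.cons_val]
    ring

variable [IsProbabilityMeasure P]

/-- For a sequence of jointly Gaussian standard variables, the variance of the power sum is
controlled by the sum of the squared correlations. -/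
lemma exists_variance_sum_abs_rpow_le {p : ℝ} (hp : 2 ≤ p) :
    ∃ K : ℝ, 0 ≤ K ∧ ∀ (X : ℕ → Ω → ℝ) (r : ℕ → ℕ → ℝ), (∀ j, Measurable (X j)) →
      (∀ j k : ℕ, ∀ α β : ℝ, ∃ v : NNReal, (v : ℝ) = α ^ 2 + β ^ 2 + 2 * α * β * r j k ∧
        P.map (fun ω => α * X j ω + β * X k ω) = gaussianReal 0 v) →
      ∀ n : ℕ, Var[fun ω => ∑ j ∈ Finset.range n, |X j ω| ^ p; P] ≤
        K * ∑ j ∈ Finset.range n, ∑ k ∈ Finset.range n, r j k ^ 2 := by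
  obtain ⟨K, hK₀, hK⟩ := exists_abs_rpow_gaussian_covariance_le hp
  refine ⟨K, hK₀, fun X r hX hXY n => ?_⟩
  have hp₀ : 0 ≤ p := by linarith
  have hlaw : ∀ j, P.map (X j) = gaussianReal 0 1 := fun j =>
    map_eq_of_linear_combinations_gaussian (hXY j j)
  have hL2 : ∀ j, MemLp (fun ω => |X j ω| ^ p) 2 P := fun j =>
    memLp_two_abs_rpow_of_map_eq (hX j) (hlaw j) hp₀
  have hmean : ∀ j, ∫ ω, |X j ω| ^ p ∂P = ∫ x, |x| ^ p ∂gaussianReal 0 1 := fun j => by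
    rw [← hlaw j, integral_map (hX j).aemeasurable (by fun_prop)]
  rw [variance_fun_sum' fun j _ => hL2 j, Finset.mul_sum]
  refine Finset.sum_le_sum fun j _ => ?_
  rw [Finset.mul_sum]
  refine Finset.sum_le_sum fun k _ => ?_
  have hr := abs_le_one_of_linear_combinations_gaussian (hXY j k)
  have hjoint := map_prodMk_eq_of_linear_combinations_gaussian (hX j) (hX k) hr (hXY j k)
  rw [covariance_eq_sub (hL2 j) (hL2 k), hmean, hmean, ← sq]
  refine (le_abs_self _).trans (le_of_eq_of_le ?_ (hK _ hr))
  congr 2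
  have h : ∫ z : ℝ × ℝ, |z.1| ^ p * |z.2| ^ p ∂P.map (fun ω => (X j ω, X k ω)) =
      ∫ ω, |X j ω| ^ p * |X k ω| ^ p ∂P :=
    integral_map ((hX j).prodMk (hX k)).aemeasurable (by fun_prop)
  simp only [Pi.mul_apply]
  rw [← h, hjoint, integral_map (by fun_prop) (by fun_prop)]

/-- Concentration of the normalised power variation around the Gaussian absolute moment. -/
lemma exists_measure_power_variation_le (hH : H ∈ Set.Ioo (0 : ℝ) (3 / 4))
    (hBmeas : ∀ t, Measurable (B t))
    (hgauss : ∀ (n : ℕ) (t : Fin n → ℝ) (a : Fin n → ℝ), ∃ v : NNReal,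
      (v : ℝ) = ∑ i, ∑ j, a i * a j *
          ((|t i| ^ (2 * H) + |t j| ^ (2 * H) - |t i - t j| ^ (2 * H)) / 2) ∧
      P.map (fun ω => ∑ i, a i * B (t i) ω) = gaussianReal 0 v)
    {p : ℝ} (hp : 2 ≤ p) :
    ∃ K : ℝ, 0 ≤ K ∧ ∀ n : ℕ, 0 < n → ∀ δ : ℝ, 0 < δ →
      P.real {ω | δ ≤ |(n : ℝ) ^ (p * H - 1) * (∑ j ∈ Finset.range n,
        |B (((j : ℝ) + 1) / n) ω - B ((j : ℝ) / n) ω| ^ p) - ∫ x, |x| ^ p ∂gaussianReal 0 1|} ≤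
        K / (n * δ ^ 2) := by
  obtain ⟨K, hK₀, hK⟩ := exists_variance_sum_abs_rpow_le (P := P) hp
  have hp₀ : 0 ≤ p := by linarith
  refine ⟨K * ∑' k : ℤ, fgnCov H k ^ 2, mul_nonneg hK₀ (tsum_nonneg fun _ => sq_nonneg _),
    fun n hn δ hδ => ?_⟩
  have hn' : (0 : ℝ) < n := by exact_mod_cast hn
  set X : ℕ → Ω → ℝ := fun j ω => (n : ℝ) ^ H * (B (((j : ℝ) + 1) / n) ω - B ((j : ℝ) / n) ω)
    with hXdef
  have hX : ∀ j, Measurable (X j) := fun j => ((hBmeas _).sub (hBmeas _)).const_mul _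
  have hXY := fun j k => exists_map_linear_combination_increments (P := P) (B := B) hH.1 hgauss
    hn j k
  have hlaw : ∀ j, P.map (X j) = gaussianReal 0 1 := fun j =>
    map_eq_of_linear_combinations_gaussian (hXY j j)
  have hL2 : ∀ j, MemLp (fun ω => |X j ω| ^ p) 2 P := fun j =>
    memLp_two_abs_rpow_of_map_eq (hX j) (hlaw j) hp₀
  have hmean : ∀ j, ∫ ω, |X j ω| ^ p ∂P = ∫ x, |x| ^ p ∂gaussianReal 0 1 := fun j => by
    rw [← hlaw j, integral_map (hX j).aemeasurable (by fun_prop)]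
  set S : Ω → ℝ := fun ω => ∑ j ∈ Finset.range n, |X j ω| ^ p with hS
  have hSL2 : MemLp S 2 P := memLp_finsetSum _ fun j _ => hL2 j
  have hSmean : ∫ ω, S ω ∂P = n * ∫ x, |x| ^ p ∂gaussianReal 0 1 := by
    rw [hS, integral_finsetSum _ fun j _ => (hL2 j).integrable (by norm_num)]
    simp [hmean]
  have hvar : Var[S; P] ≤ K * (n * ∑' k : ℤ, fgnCov H k ^ 2) :=
    (hK X _ hX hXY n).trans (mul_le_mul_of_nonneg_left (sum_fgnCov_sq_le hH.2 n) hK₀)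
  have hscale : ∀ ω, (n : ℝ) ^ (p * H - 1) * (∑ j ∈ Finset.range n,
      |B (((j : ℝ) + 1) / n) ω - B ((j : ℝ) / n) ω| ^ p) = S ω / n := fun ω => by
    rw [hS, Real.rpow_sub hn', Real.rpow_one, div_mul_eq_mul_div, Finset.mul_sum]
    congr 1
    refine Finset.sum_congr rfl fun j _ => ?_
    rw [hXdef, abs_mul, Real.mul_rpow (abs_nonneg _) (abs_nonneg _),
      abs_of_nonneg (by positivity : 0 ≤ (n : ℝ) ^ H), ← Real.rpow_mul hn'.le, mul_comm H]
  have hset : {ω | δ ≤ |(n : ℝ) ^ (p * H - 1) * (∑ j ∈ Finset.range n,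
        |B (((j : ℝ) + 1) / n) ω - B ((j : ℝ) / n) ω| ^ p) - ∫ x, |x| ^ p ∂gaussianReal 0 1|} =
      {ω | n * δ ≤ |S ω - ∫ ω, S ω ∂P|} := by
    ext ω
    simp only [Set.mem_ofPred_eq, hscale, hSmean]
    rw [show S ω - n * ∫ x, |x| ^ p ∂gaussianReal 0 1 =
      n * (S ω / n - ∫ x, |x| ^ p ∂gaussianReal 0 1) by field_simp, abs_mul, abs_of_pos hn',
      mul_le_mul_iff_right₀ hn']
  rw [hset, Measure.real]
  refine (ENNReal.toReal_mono ENNReal.ofReal_ne_top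
    (meas_ge_le_variance_div_sq hSL2 (mul_pos hn' hδ))).trans ?_
  rw [ENNReal.toReal_ofReal (div_nonneg (variance_nonneg _ _) (sq_nonneg _))]
  calc Var[S; P] / (n * δ) ^ 2 ≤ K * (n * ∑' k : ℤ, fgnCov H k ^ 2) / (n * δ) ^ 2 := by gcongr
    _ = _ := by field_simp

end PowerVariation

lemma abs_log_sub_log_le_of_abs_sub_lt {u c η : ℝ} (hc : 0 < c) (hη : η ≤ c / 2)
    (h : |u - c| < η) : |Real.log u - Real.log c| ≤ 2 * η / c := by
  obtain ⟨h₁, h₂⟩ := abs_lt.1 h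
  have hη₀ : 0 < η := (abs_nonneg _).trans_lt h
  have hu : 0 < u := by linarith
  have hlog₁ := Real.log_le_sub_one_of_pos (div_pos hu hc)
  have hlog₂ := Real.log_le_sub_one_of_pos (div_pos hc hu)
  rw [Real.log_div hu.ne' hc.ne'] at hlog₁
  rw [Real.log_div hc.ne' hu.ne'] at hlog₂
  have hb₁ : u / c - 1 ≤ 2 * η / c := by
    rw [div_sub_one hc.ne']
    gcongr
    linarith
  have hb₂ : c / u - 1 ≤ 2 * η / c := by
    rw [div_sub_one hu.ne', div_le_div_iff₀ hu hc]
    nlinarith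
  rw [abs_le]
  constructor <;> linarith

/-- The estimation error of the Hurst parameter in terms of the deviations of the two normalised
power variations. -/
lemma abs_hurst_estimator_sub_le {n lam : ℕ} (hn : 0 < n) (hlam : 1 < lam) {p H c η x y : ℝ}
    (hp : 0 < p) (hc : 0 < c) (hη : η ≤ c / 2)
    (hx : |((lam * n : ℕ) : ℝ) ^ (p * H - 1) * x - c| < η)
    (hy : |(n : ℝ) ^ (p * H - 1) * y - c| < η) :
    |(1 / p) * (1 - Real.log (x / y) / Real.log lam) - H| ≤ 4 * η / (c * p * Real.log lam) := by
  have hn' : (0 : ℝ) < n := by exact_mod_cast hn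
  have hlam₁ : (1 : ℝ) < lam := by exact_mod_cast hlam
  have hlam₀ : (0 : ℝ) < lam := by linarith
  have hloglam : 0 < Real.log lam := Real.log_pos hlam₁
  have hx' := abs_log_sub_log_le_of_abs_sub_lt hc hη hx
  have hy' := abs_log_sub_log_le_of_abs_sub_lt hc hη hy
  have hN : (0 : ℝ) < ((lam * n : ℕ) : ℝ) := by
    push_cast
    positivity
  have hx₀ : 0 < x := by
    have := (abs_lt.1 hx).1
    exact pos_of_mul_pos_right (by linarith) (by positivity :
      0 ≤ ((lam * n : ℕ) : ℝ) ^ (p * H - 1))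
  have hy₀ : 0 < y := by
    have := (abs_lt.1 hy).1
    exact pos_of_mul_pos_right (by linarith) (by positivity : 0 ≤ (n : ℝ) ^ (p * H - 1))
  rw [Real.log_mul (by positivity) hx₀.ne', Real.log_rpow hN, Nat.cast_mul,
    Real.log_mul hlam₀.ne' hn'.ne'] at hx'
  rw [Real.log_mul (by positivity) hy₀.ne', Real.log_rpow hn'] at hy'
  set E := (p * H - 1) * Real.log lam + Real.log x - Real.log y with hE
  have hEbound : |E| ≤ 4 * η / c := by
    have h4 : 4 * η / c = 2 * η / c + 2 * η / c := by ring
    obtain ⟨a₁, a₂⟩ := abs_le.1 hx'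
    obtain ⟨b₁, b₂⟩ := abs_le.1 hy'
    rw [abs_le, h4]
    constructor <;> linarith
  have herr : (1 / p) * (1 - Real.log (x / y) / Real.log lam) - H = -E / (p * Real.log lam) := by
    rw [Real.log_div hx₀.ne' hy₀.ne', hE]
    field_simp
    ring
  rw [herr, abs_div, abs_neg, abs_of_pos (by positivity : 0 < p * Real.log lam)]
  calc |E| / (p * Real.log lam) ≤ 4 * η / c / (p * Real.log lam) := by gcongr
    _ = _ := by rw [div_div, mul_assoc]

/-- consistency of the power-variation estimator of the Hurst
parameter of fractional Brownian motion: for `H ∈ (0, 3/4)`, `p ∈ {2} ∪ [3,∞)`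
and an integer scaling `λ > 1`, the estimator
`Ĥ_{λ,n} = (1/p)(1 - log(V^p_{λn}(B)/V^p_n(B)) / log λ)` satisfies
`√(n/log n) (Ĥ_{λ,n} - H) → 0` in probability. -/
theorem hurst_estimator_consistency {Ω : Type*} [MeasurableSpace Ω] (P : Measure Ω)
    [IsProbabilityMeasure P] (H : ℝ) (hH : H ∈ Set.Ioo (0 : ℝ) (3 / 4))
    (B : ℝ → Ω → ℝ) (hBmeas : ∀ t, Measurable (B t))
    (hgauss : ∀ (n : ℕ) (t : Fin n → ℝ) (a : Fin n → ℝ), ∃ v : NNReal,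
      (v : ℝ) = ∑ i, ∑ j, a i * a j *
          ((|t i| ^ (2 * H) + |t j| ^ (2 * H) - |t i - t j| ^ (2 * H)) / 2) ∧
      P.map (fun ω => ∑ i, a i * B (t i) ω) = gaussianReal 0 v)
    (p : ℝ) (hp : p = 2 ∨ 3 ≤ p) (lam : ℕ) (hlam : 1 < lam) :
    ∀ ε : ℝ, 0 < ε →
      Tendsto (fun n : ℕ =>
        (P {ω | ε < Real.sqrt ((n : ℝ) / Real.log n) *
            |(1 / p) * (1 -
              Real.log
                ((∑ j ∈ Finset.range (lam * n),
                    |B (((j : ℝ) + 1) / ((lam * n : ℕ) : ℝ)) ω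
                      - B ((j : ℝ) / ((lam * n : ℕ) : ℝ)) ω| ^ p) /
                 (∑ j ∈ Finset.range n,
                    |B (((j : ℝ) + 1) / (n : ℝ)) ω - B ((j : ℝ) / (n : ℝ)) ω| ^ p))
                / Real.log lam) - H|}).toReal)
        atTop (nhds 0) := by
  intro ε hε
  have hp2 : 2 ≤ p := by rcases hp with rfl | hp <;> linarith
  have hp₀ : 0 < p := by linarith
  obtain ⟨K, hK₀, hK⟩ := exists_measure_power_variation_le hH hBmeas hgauss hp2
  set c := ∫ x, |x| ^ p ∂gaussianReal 0 1
  have hc : 0 < c := integral_abs_rpow_gaussianReal_pos hp₀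
  have hlam' : (1 : ℝ) < lam := by exact_mod_cast hlam
  have hloglam : 0 < Real.log lam := Real.log_pos hlam'
  set κ := ε * (c * p * Real.log lam) / 4 with hκ
  have hκ₀ : 0 < κ := by positivity
  set δ : ℕ → ℝ := fun n => κ * √(Real.log n / n) with hδ
  have hlim : Tendsto (fun n : ℕ => Real.log n / (n : ℝ)) atTop (nhds 0) :=
    Real.isLittleO_log_id_atTop.tendsto_div_nhds_zero.comp tendsto_natCast_atTop_atTop
  have hδlim : Tendsto δ atTop (nhds 0) := by
    have h := hlim.sqrt.const_mul κ
    rwa [Real.sqrt_zero, mul_zero] at h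
  have hbound : Tendsto (fun n : ℕ => 2 * K / κ ^ 2 * (Real.log n)⁻¹) atTop (nhds 0) := by
    simpa using ((tendsto_inv_atTop_zero.comp Real.tendsto_log_atTop).comp
      tendsto_natCast_atTop_atTop).const_mul (2 * K / κ ^ 2)
  refine squeeze_zero' (Eventually.of_forall fun n => ENNReal.toReal_nonneg) ?_ hbound
  filter_upwards [eventually_ge_atTop 2, hδlim.eventually_le_const (half_pos hc)] with n hn hδn
  have hn₀ : 0 < n := by omega
  have hn' : (1 : ℝ) < n := by exact_mod_cast hn
  have hlogn : 0 < Real.log n := Real.log_pos hn'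
  have hN₀ : 0 < lam * n := Nat.mul_pos (by omega) hn₀
  have hδ₀ : 0 < δ n := by
    simp only [hδ]
    positivity
  have hδsq : n * δ n ^ 2 = κ ^ 2 * Real.log n := by
    simp only [hδ]
    rw [mul_pow, Real.sq_sqrt (by positivity)]
    field_simp
  have hcancel : √(n / Real.log n) * δ n = κ := by
    simp only [hδ]
    rw [mul_left_comm, ← Real.sqrt_mul (by positivity), div_mul_div_cancel₀ hlogn.ne',
      div_self (by positivity), Real.sqrt_one, mul_one]
  refine (measureReal_mono (μ := P) fun ω hω => ?_).trans ((measureReal_union_le _ _).trans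
    ((add_le_add (hK (lam * n) hN₀ (δ n) hδ₀) (hK n hn₀ (δ n) hδ₀)).trans ?_))
  · rw [Set.mem_ofPred_eq] at hω
    by_contra hcon
    simp only [Set.mem_union, Set.mem_ofPred_eq, not_or, not_le] at hcon
    refine absurd hω (not_lt.2 ?_)
    calc _ ≤ √(n / Real.log n) * (4 * δ n / (c * p * Real.log lam)) :=
          mul_le_mul_of_nonneg_left
            (abs_hurst_estimator_sub_le hn₀ hlam hp₀ hc hδn hcon.1 hcon.2) (Real.sqrt_nonneg _)
      _ = √(n / Real.log n) * δ n * (4 / (c * p * Real.log lam)) := by ring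
      _ = ε := by
        rw [hcancel, hκ]
        field_simp
  · have hle : K / (((lam * n : ℕ) : ℝ) * δ n ^ 2) ≤ K / (n * δ n ^ 2) := by
      gcongr
      exact Nat.le_mul_of_pos_left n (by omega)
    calc _ ≤ K / (n * δ n ^ 2) + K / (n * δ n ^ 2) := by gcongr
      _ = 2 * K / κ ^ 2 * (Real.log n)⁻¹ := by
        rw [hδsq]
        field_simp
        ring
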